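/- Substitution requires boundary-crossing: for channels i and j and belief b, if ΔVoI(j|i,b) < 0, then there is no action a ∈ A such that all posteriors b̂(i,o) with positive marginal probability lie in the decision region ℛ_a; equivalently, the posteriors of channel i must span at least two distinct decision regions. This holds for arbitrary (possibly correlated) channels i and j. -/

import Mathlib

open Finset

/-- `b` is a probability distribution (belief) on the finite state set `S`. -/
def IsBelief {S : Type*} [Fintype S] (b : S → ℝ) : Prop :=
  (∀ s, 0 ≤ b s) ∧ ∑ s, b s = 1

/-- `P` is a likelihood kernel: for each state `s`, `P · s` is a probability
distribution on the finite outcome set `O`. -/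
def IsKernel {S O : Type*} [Fintype S] [Fintype O] (P : O → S → ℝ) : Prop :=
  (∀ o s, 0 ≤ P o s) ∧ ∀ s, ∑ o, P o s = 1

/-- Marginal outcome probability `P(o | b, k) = ∑ s, P(o | s, k) b(s)`. -/
noncomputable def marginal {S O : Type*} [Fintype S] [Fintype O] (b : S → ℝ) (P : O → S → ℝ) (o : O) : ℝ :=
  ∑ s, P o s * b s

/-- Posterior belief `b̂(k, o)(s) = P(o | s, k) b(s) / P(o | b, k)`. -/
noncomputable def posterior {S O : Type*} [Fintype S] [Fintype O] (b : S → ℝ) (P : O → S → ℝ) (o : O)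
    (s : S) : ℝ :=
  P o s * b s / marginal b P o

/-- Jensen gap of `f` at belief `b` under the channel with kernel `P`:
`∑_{o : P(o|b) > 0} P(o|b) f(b̂(o)) − f(b)`. -/
noncomputable def jensenGap {S O : Type*} [Fintype S] [Fintype O] (f : (S → ℝ) → ℝ) (b : S → ℝ)
    (P : O → S → ℝ) : ℝ :=
  (∑ o ∈ Finset.univ.filter (fun o => 0 < marginal b P o),
      marginal b P o * f (posterior b P o)) - f b

/-- Value function `V(b) = max_{a ∈ A} ∑ s, R(a,s) b(s)`. -/
noncomputable def Val {S A : Type*} [Fintype S] [Fintype A] [Nonempty A] (R : A → S → ℝ) (b : S → ℝ) : ℝ :=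
  Finset.univ.sup' Finset.univ_nonempty (fun a => ∑ s, R a s * b s)

/-- `p` lies in the decision region `ℛ_a`. -/
def InRegion {S A : Type*} [Fintype S] (R : A → S → ℝ) (a : A) (p : S → ℝ) : Prop :=
  ∀ a', ∑ s, R a' s * p s ≤ ∑ s, R a s * p s

/-- Value of information of the channel with kernel `P` at belief `b`. -/
noncomputable def VoI {S A O : Type*} [Fintype S] [Fintype A] [Nonempty A] [Fintype O]
    (R : A → S → ℝ) (P : O → S → ℝ) (b : S → ℝ) : ℝ :=
  jensenGap (Val R) b P

/-- Second-order interaction `ΔVoI(j | i, b)`. -/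
noncomputable def deltaVoI {S A Oi Oj : Type*} [Fintype S] [Fintype A] [Nonempty A] [Fintype Oi] [Fintype Oj]
    (R : A → S → ℝ) (Pi : Oi → S → ℝ) (Pj : Oj → S → ℝ) (b : S → ℝ) : ℝ :=
  (∑ oi ∈ Finset.univ.filter (fun oi => 0 < marginal b Pi oi),
      marginal b Pi oi * VoI R Pj (posterior b Pi oi)) - VoI R Pj b

section

variable {S A O : Type*} [Fintype S] [Fintype A] [Nonempty A] [Fintype O]

theorem le_Val (R : A → S → ℝ) (x : S → ℝ) (a : A) : ∑ s, R a s * x s ≤ Val R x :=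
  Finset.le_sup' (fun a => ∑ s, R a s * x s) (Finset.mem_univ a)

theorem Val_le {R : A → S → ℝ} {x : S → ℝ} {c : ℝ} (h : ∀ a, ∑ s, R a s * x s ≤ c) :
    Val R x ≤ c :=
  Finset.sup'_le _ _ fun a _ => h a

theorem Val_eq_of_inRegion {R : A → S → ℝ} {a : A} {x : S → ℝ} (h : InRegion R a x) :
    Val R x = ∑ s, R a s * x s :=
  le_antisymm (Val_le h) (le_Val R x a)

theorem Val_smul (R : A → S → ℝ) {c : ℝ} (hc : 0 ≤ c) (x : S → ℝ) :
    Val R (c • x) = c * Val R x := by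
  have key (a : A) : ∑ s, R a s * (c • x) s = c * ∑ s, R a s * x s := by
    simp only [Pi.smul_apply, smul_eq_mul, Finset.mul_sum]
    exact Finset.sum_congr rfl fun s _ => by ring
  apply le_antisymm
  · refine Val_le fun a => ?_
    rw [key]
    exact mul_le_mul_of_nonneg_left (le_Val R x a) hc
  · obtain ⟨a, -, ha⟩ := Finset.exists_mem_eq_sup' (Finset.univ_nonempty (α := A))
      (fun a => ∑ s, R a s * x s)
    have hV : Val R x = ∑ s, R a s * x s := ha
    rw [hV, ← key]
    exact le_Val R _ a

theorem Val_sum_le (R : A → S → ℝ) (x : O → S → ℝ) :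
    Val R (∑ o, x o) ≤ ∑ o, Val R (x o) := by
  refine Val_le fun a => ?_
  simp only [Finset.sum_apply, Finset.mul_sum]
  rw [Finset.sum_comm]
  exact Finset.sum_le_sum fun o _ => le_Val R (x o) a

theorem marginal_smul_posterior {b : S → ℝ} {P : O → S → ℝ} {o : O} (h : 0 < marginal b P o) :
    marginal b P o • posterior b P o = P o * b := by
  ext s
  simp only [Pi.smul_apply, smul_eq_mul, Pi.mul_apply, posterior]
  exact mul_div_cancel₀ _ h.ne'

theorem mul_eq_zero_of_not_marginal_pos {b : S → ℝ} {P : O → S → ℝ} (hb : 0 ≤ b)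
    (hP : ∀ o s, 0 ≤ P o s) {o : O} (h : ¬ 0 < marginal b P o) : P o * b = 0 := by
  have hnn : ∀ s ∈ Finset.univ, 0 ≤ P o s * b s := fun s _ => mul_nonneg (hP o s) (hb s)
  have h0 : ∑ s, P o s * b s = 0 := le_antisymm (not_lt.1 h) (Finset.sum_nonneg hnn)
  ext s
  exact (Finset.sum_eq_zero_iff_of_nonneg hnn).1 h0 s (Finset.mem_univ s)

theorem posterior_nonneg {b : S → ℝ} {P : O → S → ℝ} (hb : 0 ≤ b)
    (hP : ∀ o s, 0 ≤ P o s) (o : O) : 0 ≤ posterior b P o := fun s =>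
  div_nonneg (mul_nonneg (hP o s) (hb s))
    (Finset.sum_nonneg fun s _ => mul_nonneg (hP o s) (hb s))

/-- The posterior expectation of a positively homogeneous function is its sum over the
unnormalised posteriors. -/
theorem sum_marginal_mul_posterior {b : S → ℝ} {P : O → S → ℝ} (hb : 0 ≤ b)
    (hP : ∀ o s, 0 ≤ P o s) {g : (S → ℝ) → ℝ}
    (hg : ∀ c : ℝ, 0 ≤ c → ∀ x, g (c • x) = c * g x) :
    ∑ o ∈ Finset.univ.filter (fun o => 0 < marginal b P o),
      marginal b P o * g (posterior b P o) = ∑ o, g (P o * b) := by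
  have hg0 : g 0 = 0 := by simpa using hg 0 le_rfl 0
  rw [Finset.sum_filter]
  refine Finset.sum_congr rfl fun o _ => ?_
  split_ifs with h
  · rw [← hg _ h.le, marginal_smul_posterior h]
  · rw [mul_eq_zero_of_not_marginal_pos hb hP h, hg0]

theorem VoI_eq (R : A → S → ℝ) {P : O → S → ℝ} {b : S → ℝ} (hb : 0 ≤ b)
    (hP : ∀ o s, 0 ≤ P o s) : VoI R P b = ∑ o, Val R (P o * b) - Val R b := by
  rw [VoI, jensenGap, sum_marginal_mul_posterior hb hP fun c hc x => Val_smul R hc x]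

theorem deltaVoI_eq {Oi Oj : Type*} [Fintype Oi] [Fintype Oj] (R : A → S → ℝ)
    {Pi : Oi → S → ℝ} {Pj : Oj → S → ℝ} {b : S → ℝ} (hb : 0 ≤ b)
    (hPi : ∀ o s, 0 ≤ Pi o s) (hPj : ∀ o s, 0 ≤ Pj o s) :
    deltaVoI R Pi Pj b =
      ∑ i, (∑ j, Val R (Pj j * (Pi i * b)) - Val R (Pi i * b)) -
        (∑ j, Val R (Pj j * b) - Val R b) := by
  rw [deltaVoI, VoI_eq R hb hPj]
  congr 1
  rw [← sum_marginal_mul_posterior hb hPi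
    (g := fun x => ∑ j, Val R (Pj j * x) - Val R x)]
  · exact Finset.sum_congr rfl fun i _ => by rw [VoI_eq R (posterior_nonneg hb hPi i) hPj]
  · intro c hc x
    simp only [mul_smul_comm, Val_smul R hc, ← Finset.mul_sum, mul_sub]

theorem IsKernel.sum_mul {P : O → S → ℝ} (hP : IsKernel P) (b : S → ℝ) :
    ∑ o, P o * b = b := by
  ext s
  simp [← Finset.sum_mul, hP.2 s]

theorem sum_Val_le_of_inRegion {R : A → S → ℝ} {P : O → S → ℝ} {b : S → ℝ} (hb : 0 ≤ b)
    (hP : IsKernel P) {a : A}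
    (ha : ∀ o, 0 < marginal b P o → InRegion R a (posterior b P o)) :
    ∑ o, Val R (P o * b) ≤ Val R b := by
  have key (o : O) : Val R (P o * b) = ∑ s, R a s * (P o * b) s := by
    by_cases h : 0 < marginal b P o
    · rw [← marginal_smul_posterior h, Val_smul R h.le, Val_eq_of_inRegion (ha o h),
        Finset.mul_sum]
      exact Finset.sum_congr rfl fun s _ => by simp only [Pi.smul_apply, smul_eq_mul]; ring
    · rw [mul_eq_zero_of_not_marginal_pos hb hP.1 h]
      simpa using Val_smul R le_rfl (0 : S → ℝ)
  calc ∑ o, Val R (P o * b) = ∑ s, R a s * (∑ o, P o * b) s := by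
        simp only [key, Finset.sum_apply, Finset.mul_sum]
        exact Finset.sum_comm
    _ ≤ Val R b := by
        rw [hP.sum_mul]
        exact le_Val R b a

end

/-- **Substitution requires boundary-crossing**: if `ΔVoI(j|i,b) < 0`, there is no
action `a` whose decision region contains all posteriors of channel `i` with
positive marginal probability. Holds for arbitrary (possibly correlated) channels. -/
theorem substitution_requires_boundary_crossing {S A Oi Oj : Type*} [Fintype S] [Nonempty S]
    [Fintype A] [Nonempty A] [Fintype Oi] [Fintype Oj]
    (R : A → S → ℝ) (Pi : Oi → S → ℝ) (Pj : Oj → S → ℝ) (b : S → ℝ)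
    (hb : IsBelief b) (hPi : IsKernel Pi) (hPj : IsKernel Pj)
    (hneg : deltaVoI R Pi Pj b < 0) :
    ¬ ∃ a : A, ∀ oi, 0 < marginal b Pi oi → InRegion R a (posterior b Pi oi) := by
  rintro ⟨a, ha⟩
  have hb0 : 0 ≤ b := hb.1
  rw [deltaVoI_eq R hb0 hPi.1 hPj.1, Finset.sum_sub_distrib, Finset.sum_comm] at hneg
  have hVal := sum_Val_le_of_inRegion hb0 hPi ha
  have hsub : ∑ j, Val R (Pj j * b) ≤ ∑ j, ∑ i, Val R (Pj j * (Pi i * b)) := by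
    refine Finset.sum_le_sum fun j _ => ?_
    have h := Val_sum_le R fun i => Pj j * (Pi i * b)
    rwa [← Finset.mul_sum, hPi.sum_mul] at h
  linarith
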